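/- For a cycle x of length k in S_n, the Möbius function of the interval [e, x] in the absolute order on S_n satisfies μ(e, x) = (−1)^{k−1} C_{k−1}, where C_m = (1/(m+1))·binom(2m, m) is the m-th Catalan number. -/

import Mathlib

open scoped Classical

/-- The reflection length of a permutation `w`: the smallest number of
transpositions whose product is `w`. -/
noncomputable def reflLen {n : ℕ} (w : Equiv.Perm (Fin n)) : ℕ :=
  sInf {k | ∃ l : List (Equiv.Perm (Fin n)), l.length = k ∧
    (∀ t ∈ l, t.IsSwap) ∧ l.prod = w}

/-- The absolute order on `S_n`: `u ⪯ v` iff `ℓ_T u + ℓ_T (u⁻¹ v) = ℓ_T v`. -/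
def AbsLe {n : ℕ} (u v : Equiv.Perm (Fin n)) : Prop :=
  reflLen u + reflLen (u⁻¹ * v) = reflLen v

namespace Equiv.Perm

section CycleWeight

variable {α : Type*} [Fintype α] [DecidableEq α] {M : Type*} [CommMonoid M]

/-- The product of `f k` over the lengths `k` of the nontrivial cycles of `z`. -/
def cycleWeight (f : ℕ → M) (z : Perm α) : M :=
  (z.cycleType.map f).prod

theorem cycleWeight_one (f : ℕ → M) : cycleWeight f (1 : Perm α) = 1 := by
  simp [cycleWeight]

theorem cycleWeight_formPerm_mul {f : ℕ → M} (hf : f 1 = 1) {l : List α} (hl : l.Nodup)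
    (hne : l ≠ []) {g : Perm α} (hg : ∀ x ∈ l, g x = x) :
    cycleWeight f (l.formPerm * g) = f l.length * cycleWeight f g := by
  have hpos : 0 < l.length := List.length_pos_iff.2 hne
  by_cases h : l.length = 1
  · obtain ⟨x, rfl⟩ := List.length_eq_one_iff.1 h
    simp [hf]
  · have hd : Disjoint l.formPerm g := fun x => by
      by_cases hx : x ∈ l
      · exact Or.inr (hg x hx)
      · exact Or.inl (List.formPerm_apply_of_notMem hx)
    have hc : l.formPerm.IsCycle := List.isCycle_formPerm hl (by omega)
    have hs : l.formPerm.support.card = l.length := by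
      rw [List.support_formPerm_of_nodup l hl (by rintro x rfl; simp at h),
        List.toFinset_card_of_nodup hl]
    simp [cycleWeight, hd.cycleType_mul, hc.cycleType, hs]

end CycleWeight

section Split

variable {α : Type*} [DecidableEq α]

theorem formPerm_append_eq_swap_mul (a b : α) (l₁ l₂ : List α)
    (h : (a :: l₁ ++ b :: l₂).Nodup) :
    (a :: l₁ ++ b :: l₂).formPerm =
      swap a b * ((a :: l₁).formPerm * (b :: l₂).formPerm) := by
  induction l₁ generalizing a with
  | nil => simp
  | cons c l₁ ih =>
    have hca : b ≠ a := by grind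
    have hcb : b ≠ c := by grind
    have hac : a ≠ c := by grind
    have h' : (c :: l₁ ++ b :: l₂).Nodup := (List.nodup_cons.1 h).2
    have e : swap a c * swap c b = swap a b * swap a c := by
      rw [mul_swap_eq_swap_mul, swap_apply_right, swap_apply_of_ne_of_ne hca hcb]
    rw [List.cons_append, List.cons_append, List.formPerm_cons_cons, List.formPerm_cons_cons,
      ← List.cons_append, ih c h', ← mul_assoc, e]
    simp only [mul_assoc]

variable [Fintype α]

theorem exists_eq_formPerm_mul (z : Perm α) {a : α} (ha : z a ≠ a) :
    ∃ (t : List α) (g : Perm α), t ≠ [] ∧ (a :: t).Nodup ∧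
      (∀ b, b ∈ a :: t ↔ z.SameCycle a b) ∧ z = (a :: t).formPerm * g ∧
      ∀ x ∈ a :: t, g x = x := by
  have ha' : a ∈ z.support := mem_support.2 ha
  have h2 : 2 ≤ (z.toList a).length := two_le_length_toList_iff_mem_support.2 ha'
  have h0 := toList_getElem_zero (p := z) (x := a) ha'
  have hm : ∀ b, b ∈ z.toList a ↔ z.SameCycle a b := fun b => by
    rw [mem_toList_iff]; exact and_iff_left ha'
  have hn := nodup_toList z a
  have hF := formPerm_toList z a
  rcases hL : z.toList a with _ | ⟨a', t⟩
  · simp [hL] at h2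
  · simp only [hL, List.getElem_cons_zero] at h0
    subst h0
    rw [hL] at hF hm hn h2
    refine ⟨t, (a' :: t).formPerm⁻¹ * z, ?_, hn, hm, by simp, fun x hx => ?_⟩
    · rintro rfl; simp at h2
    · rw [mul_apply, inv_eq_iff_eq, hF, ((hm x).1 hx).cycleOf_apply]

theorem cycleWeight_swap_mul_formPerm_mul {M : Type*} [CommMonoid M] {f : ℕ → M} (hf : f 1 = 1)
    {a b : α} {l₁ l₂ : List α} (hl : (a :: l₁ ++ b :: l₂).Nodup) {g : Perm α}
    (hg : ∀ x ∈ a :: l₁ ++ b :: l₂, g x = x) :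
    cycleWeight f (swap a b * ((a :: l₁ ++ b :: l₂).formPerm * g)) =
      f (l₁.length + 1) * (f (l₂.length + 1) * cycleWeight f g) := by
  have hd := List.nodup_append.1 hl
  rw [formPerm_append_eq_swap_mul a b l₁ l₂ hl, mul_assoc, mul_assoc, swap_mul_self_mul,
    cycleWeight_formPerm_mul hf hd.1 (by simp), cycleWeight_formPerm_mul hf hd.2.1 (by simp)]
  · simp
  · exact fun x hx => hg x (by simp_all)
  · intro x hx
    rw [mul_apply, hg x (List.mem_append_left _ hx), List.formPerm_apply_of_notMem]
    exact fun hx' => hd.2.2 x hx x hx' rfl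

/-- The sum of `k - 1` over the cycle lengths `k` of a permutation. -/
def cycleRank (z : Perm α) : ℕ :=
  (cycleWeight (fun k => Multiplicative.ofAdd (k - 1)) z).toAdd

theorem cycleRank_one : cycleRank (1 : Perm α) = 0 := by
  simp [cycleRank, cycleWeight_one]

theorem SameCycle.cycleRank_swap_mul {z : Perm α} {a b : α} (h : z.SameCycle a b) (hab : a ≠ b) :
    cycleRank (swap a b * z) + 1 = cycleRank z := by
  have ha : z a ≠ a := fun ha => hab (h.eq_of_left ha)
  obtain ⟨t, g, -, hn, hm, hz, hg⟩ := exists_eq_formPerm_mul z ha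
  have hb : b ∈ t := by simpa [hab.symm] using (hm b).2 h
  obtain ⟨l₁, l₂, rfl⟩ := List.append_of_mem hb
  have h1 := cycleWeight_formPerm_mul (f := fun k => Multiplicative.ofAdd (k - 1)) (by rfl) hn
    (by simp) hg
  have h2 := cycleWeight_swap_mul_formPerm_mul (f := fun k => Multiplicative.ofAdd (k - 1)) (by rfl)
    (l₁ := l₁) (l₂ := l₂) hn hg
  rw [List.cons_append, ← hz] at h2
  rw [← hz] at h1
  simp only [cycleRank, h1, h2, toAdd_mul, toAdd_ofAdd, List.length_cons, List.length_append]
  omega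

theorem sameCycle_swap_mul {z : Perm α} {a b : α} (h : ¬ z.SameCycle a b) :
    (swap a b * z).SameCycle a b := by
  have hex : ∃ m, 0 < m ∧ (z ^ m) a = a := ⟨orderOf z, orderOf_pos z, by simp [pow_orderOf_eq_one]⟩
  obtain ⟨hm, hma⟩ := Nat.find_spec hex
  have hmin := fun k => Nat.find_min hex (m := k)
  generalize Nat.find hex = m at hm hma hmin
  have key : ∀ k < m, ((swap a b * z) ^ k) a = (z ^ k) a := by
    intro k
    induction k with
    | zero => simp
    | succ k ih =>
      intro hk
      rw [pow_succ', mul_apply, ih (by omega), mul_apply, ← mul_apply z, ← pow_succ']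
      refine swap_apply_of_ne_of_ne (fun e => hmin _ hk ⟨by omega, e⟩) fun e => h ⟨(k + 1 : ℕ), ?_⟩
      rw [zpow_natCast, e]
  obtain ⟨k, rfl⟩ : ∃ k, m = k + 1 := ⟨m - 1, by omega⟩
  refine ⟨(k + 1 : ℕ), ?_⟩
  rw [zpow_natCast, pow_succ', mul_apply, key k (by omega), mul_apply, ← mul_apply z, ← pow_succ',
    hma, swap_apply_left]

theorem cycleRank_swap_mul_of_not_sameCycle {z : Perm α} {a b : α} (h : ¬ z.SameCycle a b) :
    cycleRank (swap a b * z) = cycleRank z + 1 := by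
  have hab : a ≠ b := fun e => h (e ▸ SameCycle.refl z a)
  rw [← (sameCycle_swap_mul h).cycleRank_swap_mul hab, swap_mul_self_mul]

end Split

section Moebius

/-- The signed Catalan number `(-1) ^ (k - 1) * C_(k - 1)`. -/
def signedCatalan (k : ℕ) : ℤ :=
  (-1) ^ (k - 1) * (catalan (k - 1) : ℤ)

theorem signedCatalan_one : signedCatalan 1 = 1 := by
  simp [signedCatalan]

theorem signedCatalan_add_sum (n : ℕ) :
    signedCatalan (n + 2) + ∑ i : Fin (n + 1), signedCatalan (i + 1) * signedCatalan (n + 1 - i)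
      = 0 := by
  have h : ∀ i : Fin (n + 1), signedCatalan (i + 1) * signedCatalan (n + 1 - i) =
      (-1) ^ n * ((catalan i * catalan (n - i) : ℕ) : ℤ) := fun i => by
    have hi : (n + 1 - i - 1 : ℕ) = n - i := by omega
    have hp : (-1 : ℤ) ^ n = (-1) ^ (i : ℕ) * (-1) ^ (n - i : ℕ) := by
      rw [← pow_add]; congr 1; omega
    simp only [signedCatalan, hi, hp, Nat.add_sub_cancel]
    push_cast
    ring
  rw [Finset.sum_congr rfl fun i _ => h i, ← Finset.mul_sum, ← Nat.cast_sum, ← catalan_succ]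
  simp only [signedCatalan, show n + 2 - 1 = n + 1 from rfl, pow_succ]
  ring

theorem sum_sameCycle_cycleWeight_swap_mul {α : Type*} [Fintype α] [DecidableEq α] (z : Perm α)
    {a : α} (ha : z a ≠ a) :
    ∑ b with z.SameCycle a b, cycleWeight signedCatalan (swap a b * z) = 0 := by
  obtain ⟨t, g, ht, hn, hm, hz, hg⟩ := exists_eq_formPerm_mul z ha
  have hfin : (Finset.univ.filter fun b => z.SameCycle a b) = (a :: t).toFinset := by
    ext b
    rw [Finset.mem_filter, List.mem_toFinset, hm]
    simp
  obtain ⟨n, hlen⟩ : ∃ n, t.length = n + 1 :=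
    ⟨t.length - 1, by have := List.length_pos_iff.2 ht; omega⟩
  have hterm : ∀ i : Fin t.length, cycleWeight signedCatalan (swap a t[i] * z) =
      signedCatalan (i + 1) * signedCatalan (n + 1 - i) * cycleWeight signedCatalan g := by
    intro i
    have e : t = t.take i ++ t[i] :: t.drop (i + 1) := by simp
    have e' : a :: t = a :: t.take i ++ t[i] :: t.drop (i + 1) := by simp
    have h := cycleWeight_swap_mul_formPerm_mul signedCatalan_one (e' ▸ hn) (g := g)
      (fun x hx => hg x (e' ▸ hx))
    rw [← e', ← hz] at h
    rw [h, mul_assoc]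
    congr 3
    · simp [i.2.le]
    · simp [hlen]; omega
  have h1 := cycleWeight_formPerm_mul signedCatalan_one hn (by simp) hg
  rw [← hz, List.length_cons, hlen] at h1
  rw [hfin, List.sum_toFinset _ hn, List.map_cons, List.sum_cons, swap_self]
  have hsum : (t.map fun b => cycleWeight signedCatalan (swap a b * z)).sum =
      ∑ i : Fin t.length, cycleWeight signedCatalan (swap a t[i] * z) := by
    rw [← List.sum_ofFn]
    congr 1
    exact List.ext_getElem (by simp) (by simp)
  rw [hsum, Finset.sum_congr rfl fun i _ => hterm i, ← Finset.sum_mul]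
  have hcast : ∑ i : Fin t.length, signedCatalan (i + 1) * signedCatalan (n + 1 - i) =
      ∑ i : Fin (n + 1), signedCatalan (i + 1) * signedCatalan (n + 1 - i) := by
    rw [hlen]
  rw [hcast, show (Equiv.refl α : Perm α) * z = z from rfl, h1, ← add_mul, signedCatalan_add_sum,
    zero_mul]

end Moebius

end Equiv.Perm

open Equiv Equiv.Perm

section AbsoluteOrder

variable {n : ℕ}

theorem cycleRank_prod_le (l : List (Perm (Fin n))) (hl : ∀ t ∈ l, t.IsSwap) :
    cycleRank l.prod ≤ l.length := by
  induction l with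
  | nil => simp [cycleRank_one]
  | cons t l ih =>
    obtain ⟨a, b, hab, rfl⟩ := hl t (by simp)
    have := ih fun t ht => hl t (by simp [ht])
    rw [List.prod_cons, List.length_cons]
    by_cases h : l.prod.SameCycle a b
    · have := h.cycleRank_swap_mul hab
      omega
    · rw [cycleRank_swap_mul_of_not_sameCycle h]
      omega

theorem exists_swaps_prod_eq (w : Perm (Fin n)) :
    ∃ l : List (Perm (Fin n)), l.length = cycleRank w ∧ (∀ t ∈ l, t.IsSwap) ∧ l.prod = w := by
  induction h : cycleRank w generalizing w with
  | zero =>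
    refine ⟨[], rfl, by simp, ?_⟩
    by_contra hw
    obtain ⟨i, hi⟩ : ∃ i, w i ≠ i := by
      by_contra! hall
      exact hw (Perm.ext hall).symm
    have := (sameCycle_apply_right.2 (SameCycle.refl w i)).cycleRank_swap_mul hi.symm
    omega
  | succ k ih =>
    obtain ⟨i, hi⟩ : ∃ i, w i ≠ i := by
      by_contra! hall
      rw [Perm.ext (σ := w) (τ := 1) hall, cycleRank_one] at h
      omega
    have := (sameCycle_apply_right.2 (SameCycle.refl w i)).cycleRank_swap_mul hi.symm
    obtain ⟨l, hl, hs, hp⟩ := ih (swap i (w i) * w) (by omega)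
    refine ⟨swap i (w i) :: l, by simp [hl], ?_, by simp [hp]⟩
    simp only [List.mem_cons, forall_eq_or_imp]
    exact ⟨⟨i, w i, hi.symm, rfl⟩, hs⟩

theorem reflLen_eq_cycleRank (w : Perm (Fin n)) : reflLen w = cycleRank w := by
  refine le_antisymm (Nat.sInf_le (exists_swaps_prod_eq w)) (le_csInf ⟨_, exists_swaps_prod_eq w⟩ ?_)
  rintro k ⟨l, rfl, hs, rfl⟩
  exact cycleRank_prod_le l hs

theorem reflLen_one : reflLen (1 : Perm (Fin n)) = 0 := by
  rw [reflLen_eq_cycleRank, cycleRank_one]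

theorem eq_one_of_reflLen_eq_zero {w : Perm (Fin n)} (h : reflLen w = 0) : w = 1 := by
  obtain ⟨l, hl, -, rfl⟩ := exists_swaps_prod_eq w
  rw [← reflLen_eq_cycleRank, h] at hl
  simp [List.length_eq_zero_iff.1 hl]

theorem reflLen_mul_le (u v : Perm (Fin n)) : reflLen (u * v) ≤ reflLen u + reflLen v := by
  obtain ⟨l, hl, hs, hp⟩ := exists_swaps_prod_eq u
  obtain ⟨l', hl', hs', hp'⟩ := exists_swaps_prod_eq v
  rw [reflLen_eq_cycleRank u, reflLen_eq_cycleRank v]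
  refine Nat.sInf_le ⟨l ++ l', by simp [hl, hl'], fun t ht => ?_, by simp [hp, hp']⟩
  exact (List.mem_append.1 ht).elim (hs t) (hs' t)

theorem reflLen_swap_le (a b : Fin n) : reflLen (swap a b) ≤ 1 := by
  by_cases h : a = b
  · subst h
    rw [swap_self, show (Equiv.refl (Fin n)) = (1 : Perm (Fin n)) from rfl, reflLen_one]
    omega
  · exact Nat.sInf_le ⟨[swap a b], rfl, by simpa using ⟨a, b, h, rfl⟩, by simp⟩

theorem Equiv.Perm.SameCycle.reflLen_swap_mul {z : Perm (Fin n)} {a b : Fin n}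
    (h : z.SameCycle a b) (hab : a ≠ b) : reflLen (swap a b * z) + 1 = reflLen z := by
  simpa only [reflLen_eq_cycleRank] using h.cycleRank_swap_mul hab

theorem absLe_refl (x : Perm (Fin n)) : AbsLe x x := by
  simp [AbsLe, reflLen_one]

theorem AbsLe.trans {u v w : Perm (Fin n)} (huv : AbsLe u v) (hvw : AbsLe v w) : AbsLe u w := by
  unfold AbsLe at *
  have h1 := reflLen_mul_le u (u⁻¹ * w)
  have h2 := reflLen_mul_le (u⁻¹ * v) (v⁻¹ * w)
  rw [mul_inv_cancel_left] at h1
  rw [mul_assoc, mul_inv_cancel_left] at h2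
  omega

theorem AbsLe.reflLen_lt {u v : Perm (Fin n)} (h : AbsLe u v) (hne : u ≠ v) :
    reflLen u < reflLen v := by
  have : reflLen (u⁻¹ * v) ≠ 0 := fun h0 =>
    hne (inv_mul_eq_one.1 (eq_one_of_reflLen_eq_zero h0))
  unfold AbsLe at h
  omega

theorem Equiv.Perm.SameCycle.absLe_swap_mul {z : Perm (Fin n)} {a b : Fin n}
    (h : z.SameCycle a b) : AbsLe (swap a b * z) z := by
  by_cases hab : a = b
  · subst hab
    rw [swap_self]
    exact absLe_refl z
  · have h1 := h.reflLen_swap_mul hab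
    have h2 := reflLen_mul_le (swap a b * z) ((swap a b * z)⁻¹ * z)
    have h3 : (swap a b * z)⁻¹ * z = swap (z⁻¹ a) (z⁻¹ b) := by
      rw [mul_inv_rev, swap_inv, mul_assoc, swap_mul_eq_mul_swap, inv_mul_cancel_left]
    have h4 := reflLen_swap_le (z⁻¹ a) (z⁻¹ b)
    rw [mul_inv_cancel_left] at h2
    unfold AbsLe
    rw [h3] at h2 ⊢
    omega

/-- Multiplying `y ⪯ c` by the transposition which makes it agree with `c` at `i` gives an element
of the interval below `c` in which the two points transposed lie in the same cycle. -/
theorem AbsLe.swap_mul {y c : Perm (Fin n)} (h : AbsLe y c) (i : Fin n) :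
    AbsLe (swap (c i) (y i) * y) c ∧ (swap (c i) (y i) * y).SameCycle (c i) (y i) := by
  by_cases hi : c i = y i
  · rw [hi, swap_self]
    exact ⟨h, SameCycle.refl _ _⟩
  set z := swap (c i) (y i) * y with hz
  set w := y⁻¹ * c with hw
  have hwi : i ≠ w i := fun e => hi (by rw [hw, mul_apply, eq_inv_iff_eq] at e; exact e.symm)
  have h1 := (sameCycle_apply_right.2 (SameCycle.refl w i)).reflLen_swap_mul hwi
  have h2 : z⁻¹ * c = swap i (w i) * w := by
    rw [hz, mul_inv_rev, swap_inv, mul_swap_eq_swap_mul, mul_assoc, swap_comm]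
    simp [hw]
  have h3 := reflLen_mul_le z (z⁻¹ * c)
  have h4 := reflLen_mul_le (swap (c i) (y i)) y
  have h5 := reflLen_swap_le (c i) (y i)
  have hyz : swap (c i) (y i) * z = y := by rw [hz, swap_mul_self_mul]
  rw [mul_inv_cancel_left] at h3
  rw [← hz] at h4
  unfold AbsLe at h ⊢
  rw [← hw] at h
  rw [h2] at h3 ⊢
  refine ⟨by omega, ?_⟩
  by_contra hs
  have h6 := cycleRank_swap_mul_of_not_sameCycle hs
  rw [hyz, ← reflLen_eq_cycleRank, ← reflLen_eq_cycleRank] at h6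
  omega

theorem sum_absLe_cycleWeight_signedCatalan {c : Perm (Fin n)} (hc : c ≠ 1) :
    ∑ y with AbsLe y c, cycleWeight signedCatalan y = 0 := by
  obtain ⟨i, hi⟩ : ∃ i, c i ≠ i := by
    by_contra! hall
    exact hc (Perm.ext hall)
  have hfib : ∑ z with AbsLe z c ∧ z i = c i, ∑ b with z.SameCycle (c i) b,
      cycleWeight signedCatalan (swap (c i) b * z) = 0 := by
    refine Finset.sum_eq_zero fun z hz => sum_sameCycle_cycleWeight_swap_mul z fun e => hi ?_
    rw [Finset.mem_filter] at hz
    exact z.injective (e.trans hz.2.2.symm)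
  rw [← hfib, Finset.sum_sigma']
  refine Finset.sum_bij' (fun y _ => ⟨swap (c i) (y i) * y, y i⟩)
    (fun p _ => swap (c i) p.2 * p.1) ?_ ?_ ?_ ?_ ?_
  · intro y hy
    have := (Finset.mem_filter.1 hy).2.swap_mul i
    simp [this.1, this.2]
  · rintro ⟨z, b⟩ hp
    simp only [Finset.mem_sigma, Finset.mem_filter, Finset.mem_univ, true_and] at hp ⊢
    exact hp.2.absLe_swap_mul.trans hp.1.1
  · intro y _
    simp
  · rintro ⟨z, b⟩ hp
    simp only [Finset.mem_sigma, Finset.mem_filter, Finset.mem_univ, true_and] at hp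
    simp [hp.1.2]
  · intro y _
    simp

end AbsoluteOrder

/-- For a cycle `x` of length `k` in `S_n`, the Möbius function of the interval
`[e, x]` of the absolute order satisfies `μ(e, x) = (-1)^(k-1) C_(k-1)`, where
`C_m` is the `m`-th Catalan number. Here `μ` is any function satisfying the
defining recursion of the Möbius function `μ(e, ·)` on the interval `[e, x]`. -/
theorem moebius_cycle {n : ℕ} (x : Equiv.Perm (Fin n)) (hx : x.IsCycle)
    (μ : Equiv.Perm (Fin n) → ℤ) (hμ1 : μ 1 = 1)
    (hμ : ∀ z : Equiv.Perm (Fin n), AbsLe z x → z ≠ 1 →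
      (∑ y : Equiv.Perm (Fin n), if AbsLe y z then μ y else 0) = 0) :
    μ x = (-1) ^ (x.support.card - 1) * (catalan (x.support.card - 1) : ℤ) := by
  have key : ∀ m, ∀ z, reflLen z = m → AbsLe z x → μ z = cycleWeight signedCatalan z := by
    intro m
    induction m using Nat.strong_induction_on with
    | _ m ih =>
      rintro z rfl hz
      by_cases h1 : z = 1
      · rw [h1, hμ1, cycleWeight_one]
      have hsum := hμ z hz h1
      have hmem : z ∈ Finset.univ.filter fun y => AbsLe y z := by simp [absLe_refl]
      rw [← Finset.sum_filter, ← sum_absLe_cycleWeight_signedCatalan h1,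
        ← Finset.add_sum_erase _ _ hmem, ← Finset.add_sum_erase _ _ hmem] at hsum
      refine add_right_cancel (hsum.trans (congrArg _ (Finset.sum_congr rfl fun y hy => ?_)).symm)
      obtain ⟨hne, hy⟩ := Finset.mem_erase.1 hy
      have hyz := (Finset.mem_filter.1 hy).2
      exact ih _ (hyz.reflLen_lt hne) y rfl (hyz.trans hz)
  rw [key _ x rfl (absLe_refl x), cycleWeight, hx.cycleType]
  simp [signedCatalan]
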